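/- Distinct choices of γ give distinct primitive p-th roots of unity: if γ and γ′ are elements of L with γ^(p−1) = −p and γ′^(p−1) = −p, and if E_γ(1) = E_{γ′}(1) (the sums of the respective Dwork series at 1), then γ = γ′. -/

import Mathlib

/-- The `n`-th coefficient `e n` of Dwork's exponential power series
`E_γ(X) = exp(γ X − γ X^p) = Σ_{n ≥ 0} e_n X^n`, the formal power series obtained by
substituting the constant-term-zero series `γ X − γ X^p` into
`exp(X) = Σ_{n ≥ 0} X^n / n!`.  Expanding `exp(γ X) · exp(−γ X^p)` gives the explicit
convolution formula `e_n = Σ_{i + p·j = n} (γ^i / i!) · ((−γ)^j / j!)`. -/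
noncomputable def dworkCoeff (L : Type*) [Field L] (p : ℕ) (γ : L) (n : ℕ) : L :=
  ∑ j ∈ Finset.range (n / p + 1),
    (γ ^ (n - p * j) / ((n - p * j).factorial : L)) * ((-γ) ^ j / (j.factorial : L))

open PowerSeries

theorem derivative_expand {R : Type*} [CommRing R] (q : ℕ) (hq : q ≠ 0)
    (U : R⟦X⟧) :
    d⁄dX R (expand q hq U) = (q : R⟦X⟧) * X ^ (q - 1) * expand q hq (d⁄dX R U) := by
  rw [expand_apply, expand_apply, derivative_subst (HasSubst.X_pow hq), derivative_pow,
    derivative_X]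
  ring

section LogDerivative

variable {K : Type*} [Field K] [CharZero K]

theorem eq_of_derivative_eq_mul {U V φ : K⟦X⟧} (hU : d⁄dX K U = U * φ) (hV : d⁄dX K V = V * φ)
    (hU0 : constantCoeff U = 1) (hV0 : constantCoeff V = 1) : U = V := by
  have hVV : V * V⁻¹ = 1 := PowerSeries.mul_inv_cancel V (by simp [hV0])
  have h : U * V⁻¹ = 1 := by
    apply derivative.ext
    · rw [Derivation.leibniz, derivative_inv', hU, hV, derivative_one, smul_eq_mul, smul_eq_mul]
      linear_combination (-U * V⁻¹ * φ) * hVV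
    · simp [hU0, hV0]
  calc U = U * V⁻¹ * V := by rw [mul_assoc, mul_comm V⁻¹, hVV, mul_one]
    _ = V := by rw [h, one_mul]

theorem exists_derivative_eq_mul (φ : K⟦X⟧) :
    ∃ U : K⟦X⟧, constantCoeff U = 1 ∧ d⁄dX K U = U * φ := by
  set ψ : K⟦X⟧ := X * PowerSeries.mk fun n => coeff n φ / (n + 1) with hψ
  have hψ0 : constantCoeff ψ = 0 := by simp [hψ]
  have hs : HasSubst ψ := HasSubst.of_constantCoeff_zero' hψ0
  refine ⟨(exp K).subst ψ, ?_, ?_⟩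
  · refine (constantCoeff_subst hs _).trans ?_
    rw [finsum_eq_single _ 0]
    · simp
    · intro d hd
      rw [map_pow]
      erw [hψ0]
      simp [hd]
  · rw [derivative_subst hs, derivative_exp]
    congr 1
    ext n
    have : (n : K) + 1 ≠ 0 := by exact_mod_cast n.succ_ne_zero
    rw [coeff_derivative, hψ, coeff_succ_X_mul, coeff_mk, div_mul_cancel₀ _ this]

theorem derivative_rescale_exp (c : K) :
    d⁄dX K (rescale c (exp K)) = rescale c (exp K) * C c := by
  ext n
  have : (n : K) + 1 ≠ 0 := by exact_mod_cast n.succ_ne_zero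
  simp [coeff_derivative, coeff_exp, Nat.factorial_succ, pow_succ]
  field_simp

end LogDerivative

section Integrality

variable {p : ℕ} [hp : Fact p.Prime]

theorem norm_prime_pow_div_factorial_le {n : ℕ} (hn : n ≠ 0) :
    ‖(p : ℚ_[p]) ^ n / (n.factorial : ℚ_[p])‖ ≤ (p : ℝ)⁻¹ := by
  have hp1 : (1 : ℝ) ≤ p := by exact_mod_cast hp.out.one_le
  have hp0 : (p : ℝ) ≠ 0 := by positivity
  rw [norm_div, norm_pow, Padic.norm_p, Padic.norm_eq_zpow_neg_valuation
    (by exact_mod_cast n.factorial_ne_zero), Padic.valuation_natCast]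
  have h := padicValNat_factorial_lt_of_ne_zero p hn
  obtain ⟨k, hk⟩ : ∃ k, n = padicValNat p n.factorial + 1 + k := Nat.exists_eq_add_of_le h
  rw [zpow_neg, zpow_natCast, div_inv_eq_mul]
  nth_rw 1 [hk]
  rw [pow_add, pow_add, pow_one, inv_pow]
  have : (0 : ℝ) < p ^ padicValNat p n.factorial := by positivity
  calc _ = (p : ℝ)⁻¹ * ((p : ℝ)⁻¹) ^ k := by field_simp
    _ ≤ (p : ℝ)⁻¹ * 1 := by
      gcongr
      exact pow_le_one₀ (by positivity) (inv_le_one_of_one_le₀ hp1)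
    _ = _ := mul_one _

theorem norm_coeff_map_pow_sub_expand_le (P : Polynomial ℤ_[p]) (n : ℕ) :
    ‖(((P ^ p).coeff n - (Polynomial.expand ℤ_[p] p P).coeff n : ℤ_[p]) : ℚ_[p])‖ ≤ (p : ℝ)⁻¹ := by
  have h : (P ^ p).coeff n - (Polynomial.expand ℤ_[p] p P).coeff n ∈
      RingHom.ker (PadicInt.toZMod (p := p)) := by
    rw [RingHom.mem_ker, map_sub, ← Polynomial.coeff_map, ← Polynomial.coeff_map,
      Polynomial.map_pow, Polynomial.map_expand, ZMod.expand_card, sub_self]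
  rw [PadicInt.ker_toZMod, PadicInt.maximalIdeal_eq_span_p, Ideal.mem_span_singleton] at h
  obtain ⟨w, hw⟩ := h
  rw [hw, ← PadicInt.norm_def, norm_mul, PadicInt.norm_p]
  exact mul_le_of_le_one_right (by positivity) w.norm_le_one

/-- A form of Dwork's lemma. -/
theorem norm_coeff_le_one_of_pow_eq {F : ℚ_[p]⟦X⟧} (h0 : constantCoeff F = 1)
    (hF : F ^ p = expand p hp.out.ne_zero F * rescale (p : ℚ_[p]) (exp ℚ_[p])) (n : ℕ) :
    ‖coeff n F‖ ≤ 1 := by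
  have hpos : (0 : ℝ) < (p : ℝ)⁻¹ := by have := hp.out.pos; positivity
  induction n using Nat.strong_induction_on with
  | _ n ih =>
  rcases Nat.eq_zero_or_pos n with rfl | hn
  · simp [h0]
  have hlift : trunc n F ∈ Polynomial.lifts (algebraMap ℤ_[p] ℚ_[p]) := by
    rw [Polynomial.lifts_iff_coeff_lifts]
    intro m
    rw [coeff_trunc]
    split_ifs with hm
    · exact ⟨⟨_, ih m hm⟩, rfl⟩
    · exact ⟨0, map_zero _⟩
  obtain ⟨P, hP⟩ := hlift
  rw [Polynomial.coe_mapRingHom] at hP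
  set Q : ℚ_[p]⟦X⟧ := ((trunc n F : Polynomial ℚ_[p]) : ℚ_[p]⟦X⟧) with hQ
  have hQc (m : ℕ) : coeff m Q = if m < n then coeff m F else 0 := by
    rw [hQ, Polynomial.coeff_coe, coeff_trunc]
  have hQ0 : constantCoeff Q = 1 := by
    rw [← coeff_zero_eq_constantCoeff_apply, hQc, if_pos hn, coeff_zero_eq_constantCoeff_apply, h0]
  obtain ⟨G, hG⟩ : X ^ n ∣ F - Q := by
    rw [X_pow_dvd_iff]
    intro m hm
    rw [map_sub, hQc, if_pos hm, sub_self]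
  have hGn : constantCoeff G = coeff n F := by
    have := congrArg (coeff n) hG
    rw [map_sub, hQc, if_neg (lt_irrefl n), sub_zero] at this
    rw [this, coeff_X_pow_mul', if_pos le_rfl, Nat.sub_self, coeff_zero_eq_constantCoeff_apply]
  have hleft : coeff n (F ^ p) = coeff n (Q ^ p) + p * coeff n F := by
    have h1 := (Commute.all F Q).mul_geom_sum₂ p
    rw [hG, mul_assoc] at h1
    have h2 := congrArg (coeff n) h1
    rw [coeff_X_pow_mul', if_pos le_rfl, Nat.sub_self, coeff_zero_eq_constantCoeff_apply, map_sub,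
      map_mul, map_sum, hGn] at h2
    simp only [map_mul, map_pow, h0, hQ0, one_pow, mul_one, Finset.sum_const, Finset.card_range,
      nsmul_eq_mul] at h2
    linear_combination -h2
  have hQp : coeff n (Q ^ p) = ((P ^ p).coeff n : ℤ_[p]) := by
    rw [hQ, ← Polynomial.coe_pow, Polynomial.coeff_coe, ← hP, ← Polynomial.map_pow,
      Polynomial.coeff_map]
    rfl
  have hexp : coeff n (expand p hp.out.ne_zero F) =
      ((Polynomial.expand ℤ_[p] p P).coeff n : ℤ_[p]) := by
    rw [coeff_expand, Polynomial.coeff_expand hp.out.pos]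
    split_ifs with hd
    · have := congrArg (fun f => Polynomial.coeff f (n / p)) hP
      rw [Polynomial.coeff_map, coeff_trunc, if_pos (Nat.div_lt_self hn hp.out.one_lt)] at this
      exact this.symm
    · rfl
  have hright : ‖coeff n (expand p hp.out.ne_zero F * rescale (p : ℚ_[p]) (exp ℚ_[p])) -
      coeff n (expand p hp.out.ne_zero F)‖ ≤ (p : ℝ)⁻¹ := by
    rw [← map_sub, ← mul_sub_one, coeff_mul]
    refine IsUltrametricDist.norm_sum_le_of_forall_le_of_nonneg hpos.le fun ij hij => ?_
    rw [Finset.HasAntidiagonal.mem_antidiagonal] at hij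
    rw [norm_mul]
    have h1 : ‖coeff ij.1 (expand p hp.out.ne_zero F)‖ ≤ 1 := by
      rw [coeff_expand]
      split_ifs with hd
      · refine ih _ ?_
        calc ij.1 / p ≤ n / p := Nat.div_le_div_right (by lia)
          _ < n := Nat.div_lt_self hn hp.out.one_lt
      · simp
    have h2 : ‖coeff ij.2 (rescale (p : ℚ_[p]) (exp ℚ_[p]) - 1)‖ ≤ (p : ℝ)⁻¹ := by
      rcases eq_or_ne ij.2 0 with h | h
      · rw [h, map_sub, coeff_rescale]
        simp
      · rw [map_sub, coeff_one, if_neg h, sub_zero, coeff_rescale, coeff_exp]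
        simpa [div_eq_mul_inv] using norm_prime_pow_div_factorial_le (p := p) h
    calc _ ≤ 1 * (p : ℝ)⁻¹ := mul_le_mul h1 h2 (norm_nonneg _) zero_le_one
      _ = _ := one_mul _
  have key : (p : ℚ_[p]) * coeff n F = (coeff n (expand p hp.out.ne_zero F *
      rescale (p : ℚ_[p]) (exp ℚ_[p])) - coeff n (expand p hp.out.ne_zero F)) +
      -((((P ^ p).coeff n - (Polynomial.expand ℤ_[p] p P).coeff n : ℤ_[p]) : ℚ_[p])) := by
    rw [← hF, hleft, hQp, hexp]
    push_cast
    ring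
  have hle : ‖(p : ℚ_[p]) * coeff n F‖ ≤ (p : ℝ)⁻¹ := by
    rw [key]
    refine (IsUltrametricDist.norm_add_le_max _ _).trans (max_le hright ?_)
    rw [norm_neg]
    exact norm_coeff_map_pow_sub_expand_le P n
  rw [norm_mul, Padic.norm_p] at hle
  exact le_of_mul_le_mul_left (by rwa [mul_one]) hpos

open scoped Classical in
/-- The logarithmic derivative `∑ X ^ (p ^ i - 1)` of the Artin–Hasse exponential. -/
noncomputable def artinHasseLogDeriv (p : ℕ) [Fact p.Prime] : ℚ_[p]⟦X⟧ :=
  PowerSeries.mk fun n => if ∃ i, n + 1 = p ^ i then 1 else 0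

theorem norm_coeff_artinHasseLogDeriv_le (n : ℕ) : ‖coeff n (artinHasseLogDeriv p)‖ ≤ 1 := by
  classical
  rw [artinHasseLogDeriv, coeff_mk]
  split_ifs <;> simp

theorem artinHasseLogDeriv_eq : artinHasseLogDeriv p =
    1 + X ^ (p - 1) * expand p hp.out.ne_zero (artinHasseLogDeriv p) := by
  classical
  have hp2 := hp.out.two_le
  ext n
  rw [map_add, coeff_one, coeff_X_pow_mul', coeff_expand]
  simp only [artinHasseLogDeriv, coeff_mk]
  rcases eq_or_ne n 0 with rfl | hn
  · rw [if_pos ⟨0, by simp⟩, if_pos rfl, if_neg (by lia), add_zero]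
  rw [if_neg hn, zero_add]
  by_cases hd : p ∣ n + 1
  · obtain ⟨m, hm⟩ := hd
    obtain ⟨k, rfl⟩ : ∃ k, m = k + 1 := Nat.exists_eq_succ_of_ne_zero (by rintro rfl; simp at hm)
    have h1 : n - (p - 1) = p * k := by rw [mul_add] at hm; lia
    have h2 : p - 1 ≤ n := by rw [mul_add] at hm; lia
    rw [if_pos h2, h1, if_pos (dvd_mul_right p k), Nat.mul_div_cancel_left _ hp.out.pos, hm]
    refine if_congr ⟨?_, ?_⟩ rfl rfl
    · rintro ⟨i, hi⟩
      rcases i with _ | i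
      · rw [pow_zero] at hi; lia
      · exact ⟨i, Nat.eq_of_mul_eq_mul_left hp.out.pos (by rw [hi, pow_succ'])⟩
    · rintro ⟨i, hi⟩
      exact ⟨i + 1, by rw [hi, pow_succ']⟩
  · rw [if_neg]
    · split_ifs with h1 h2
      · exact absurd ((Nat.dvd_add_right (dvd_refl p)).mpr h2) (by
          rwa [show p + (n - (p - 1)) = n + 1 by lia])
      all_goals rfl
    · rintro ⟨i, hi⟩
      rcases i with _ | i
      · rw [pow_zero] at hi; lia
      · exact hd (hi ▸ dvd_pow_self p i.succ_ne_zero)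

theorem norm_coeff_le_one_of_derivative_eq {F : ℚ_[p]⟦X⟧} (h0 : constantCoeff F = 1)
    (hF : d⁄dX ℚ_[p] F = F * artinHasseLogDeriv p) (n : ℕ) : ‖coeff n F‖ ≤ 1 := by
  refine norm_coeff_le_one_of_pow_eq h0 ?_ n
  refine eq_of_derivative_eq_mul (φ := (p : ℚ_[p]⟦X⟧) * artinHasseLogDeriv p) ?_ ?_ ?_ ?_
  · rw [derivative_pow, hF, ← pow_sub_one_mul hp.out.ne_zero F]
    ring
  · rw [Derivation.leibniz, derivative_expand, derivative_rescale_exp, hF, map_mul, smul_eq_mul,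
      smul_eq_mul, map_natCast]
    conv_rhs => rw [artinHasseLogDeriv_eq]
    ring
  · simp [h0]
  · rw [map_mul, constantCoeff_expand, h0, ← coeff_zero_eq_constantCoeff_apply, coeff_rescale]
    simp

theorem norm_coeff_mul_le_one_of_derivative_eq {S : ℚ_[p]⟦X⟧} (h0 : constantCoeff S = 1)
    (hS : d⁄dX ℚ_[p] S = S * (C (-((p : ℚ_[p]) ^ 2)⁻¹) * artinHasseLogDeriv p)) (m : ℕ) :
    ‖(p : ℚ_[p]) ^ (2 * m) * m.factorial * coeff m S‖ ≤ 1 := by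
  have hp0 : (p : ℚ_[p]) ≠ 0 := by exact_mod_cast hp.out.ne_zero
  have hnat (k : ℕ) : ‖(k : ℚ_[p])‖ ≤ 1 := IsUltrametricDist.norm_natCast_le_one _ k
  induction m using Nat.strong_induction_on with
  | _ m ih =>
  rcases m with _ | m
  · simp [h0]
  have h := congrArg (coeff m) hS
  rw [coeff_derivative, mul_left_comm, coeff_C_mul, coeff_mul] at h
  have key : (p : ℚ_[p]) ^ (2 * (m + 1)) * (m + 1).factorial * coeff (m + 1) S =
      -∑ ij ∈ Finset.HasAntidiagonal.antidiagonal m, (p : ℚ_[p]) ^ (2 * m) * m.factorial * coeff ij.1 S *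
        coeff ij.2 (artinHasseLogDeriv p) := by
    simp only [mul_assoc]
    rw [← Finset.mul_sum, ← Finset.mul_sum, Nat.factorial_succ]
    push_cast
    calc _ = (p : ℚ_[p]) ^ (2 * m) * m.factorial * p ^ 2 * (coeff (m + 1) S * (m + 1)) := by ring
      _ = _ := by rw [h]; field_simp
  rw [key, norm_neg]
  refine IsUltrametricDist.norm_sum_le_of_forall_le_of_nonneg zero_le_one fun ij hij => ?_
  rw [Finset.HasAntidiagonal.mem_antidiagonal] at hij
  obtain ⟨k, hk⟩ := Nat.factorial_dvd_factorial (show ij.1 ≤ m by lia)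
  have : (p : ℚ_[p]) ^ (2 * m) * m.factorial * coeff ij.1 S * coeff ij.2 (artinHasseLogDeriv p) =
      ((p ^ (2 * ij.2) * k : ℕ) : ℚ_[p]) * (p ^ (2 * ij.1) * ij.1.factorial * coeff ij.1 S) *
        coeff ij.2 (artinHasseLogDeriv p) := by
    rw [hk, ← hij]
    push_cast
    ring
  rw [this, norm_mul, norm_mul]
  exact mul_le_one₀ (mul_le_one₀ (hnat _) (norm_nonneg _) (ih _ (by lia))) (norm_nonneg _)
    (norm_coeff_artinHasseLogDeriv_le _)

/-- The power series `exp (X + X ^ p / p)`. -/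
noncomputable def truncatedArtinHasse (p : ℕ) [hp : Fact p.Prime] : ℚ_[p]⟦X⟧ :=
  exp ℚ_[p] * expand p hp.out.ne_zero (rescale (p : ℚ_[p])⁻¹ (exp ℚ_[p]))

theorem constantCoeff_truncatedArtinHasse : constantCoeff (truncatedArtinHasse p) = 1 := by
  rw [truncatedArtinHasse, map_mul, constantCoeff_expand, ← coeff_zero_eq_constantCoeff_apply,
    ← coeff_zero_eq_constantCoeff_apply, coeff_rescale]
  simp

theorem derivative_truncatedArtinHasse :
    d⁄dX ℚ_[p] (truncatedArtinHasse p) = truncatedArtinHasse p * (1 + X ^ (p - 1)) := by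
  have h : (p : ℚ_[p]⟦X⟧) * C (p : ℚ_[p])⁻¹ = 1 := by
    rw [← map_natCast (C (R := ℚ_[p])), ← map_mul,
      mul_inv_cancel₀ (by exact_mod_cast hp.out.ne_zero), map_one]
  rw [truncatedArtinHasse, Derivation.leibniz, derivative_expand, derivative_rescale_exp, map_mul,
    derivative_exp, expand_C, smul_eq_mul, smul_eq_mul]
  linear_combination (exp ℚ_[p] * expand p hp.out.ne_zero (rescale (p : ℚ_[p])⁻¹ (exp ℚ_[p])) *
    X ^ (p - 1)) * h

theorem exists_truncatedArtinHasse_eq : ∃ F S : ℚ_[p]⟦X⟧, (∀ n, ‖coeff n F‖ ≤ 1) ∧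
    (∀ m, ‖(p : ℚ_[p]) ^ (2 * m) * m.factorial * coeff m S‖ ≤ 1) ∧
    truncatedArtinHasse p =
      F * expand (p * p) (mul_ne_zero hp.out.ne_zero hp.out.ne_zero) S := by
  obtain ⟨F, hF0, hF⟩ := exists_derivative_eq_mul (artinHasseLogDeriv p)
  obtain ⟨S, hS0, hS⟩ := exists_derivative_eq_mul
    (C (-((p : ℚ_[p]) ^ 2)⁻¹) * artinHasseLogDeriv p)
  refine ⟨F, S, norm_coeff_le_one_of_derivative_eq hF0 hF,
    norm_coeff_mul_le_one_of_derivative_eq hS0 hS, ?_⟩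
  refine eq_of_derivative_eq_mul derivative_truncatedArtinHasse ?_
    constantCoeff_truncatedArtinHasse (by simp [hF0, hS0])
  have h : ((p * p : ℕ) : ℚ_[p]⟦X⟧) * C (-((p : ℚ_[p]) ^ 2)⁻¹) = -1 := by
    rw [← map_natCast (C (R := ℚ_[p])), ← map_mul]
    have hp0 : (p : ℚ_[p]) ≠ 0 := by exact_mod_cast hp.out.ne_zero
    rw [show ((p * p : ℕ) : ℚ_[p]) * -((p : ℚ_[p]) ^ 2)⁻¹ = -1 by push_cast; field_simp]
    simp
  have hφ : artinHasseLogDeriv p = 1 + X ^ (p - 1) + X ^ (p * p - 1) *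
      expand (p * p) (mul_ne_zero hp.out.ne_zero hp.out.ne_zero) (artinHasseLogDeriv p) := by
    have hexp : p * p - 1 = p - 1 + p * (p - 1) := by
      obtain ⟨k, hk⟩ := Nat.exists_eq_succ_of_ne_zero hp.out.ne_zero
      rw [hk, Nat.succ_sub_one, Nat.succ_mul_succ]
      lia
    have h1 := congrArg (expand p hp.out.ne_zero) (artinHasseLogDeriv_eq (p := p))
    rw [map_add, map_mul, map_one, map_pow, expand_X, ← pow_mul, ← expand_mul] at h1
    conv_lhs => rw [artinHasseLogDeriv_eq, h1]
    rw [hexp, pow_add]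
    ring
  rw [Derivation.leibniz, derivative_expand, hF, hS, map_mul, map_mul, expand_C, smul_eq_mul,
    smul_eq_mul]
  linear_combination (F * expand (p * p) (mul_ne_zero hp.out.ne_zero hp.out.ne_zero) S) * hφ +
    (F * X ^ (p * p - 1) * expand (p * p) (mul_ne_zero hp.out.ne_zero hp.out.ne_zero) S *
      expand (p * p) (mul_ne_zero hp.out.ne_zero hp.out.ne_zero) (artinHasseLogDeriv p)) * h

theorem pow_le_norm_factorial {q : ℝ} (hq0 : 0 ≤ q) (hq1 : q ≤ 1) (hq : q ^ (p - 1) = (p : ℝ)⁻¹)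
    (m : ℕ) : q ^ m ≤ ‖(m.factorial : ℚ_[p])‖ := by
  rw [Padic.norm_eq_zpow_neg_valuation (by exact_mod_cast m.factorial_ne_zero),
    Padic.valuation_natCast, zpow_neg, zpow_natCast, ← inv_pow, ← hq, ← pow_mul,
    sub_one_mul_padicValNat_factorial]
  exact pow_le_pow_of_le_one hq0 hq1 (Nat.sub_le _ _)

theorem norm_coeff_truncatedArtinHasse_mul_pow_le {q : ℝ} (hq0 : 0 < q) (hq1 : q ≤ 1)
    (hq : q ^ (p - 1) = (p : ℝ)⁻¹) (n : ℕ) :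
    ‖coeff n (truncatedArtinHasse p)‖ * q ^ n ≤ q ^ (n - (2 * p - 1) * (n / (p * p))) := by
  obtain ⟨F, S, hF, hS, h⟩ := exists_truncatedArtinHasse_eq (p := p)
  have hp2 := hp.out.two_le
  rw [← le_div_iff₀ (by positivity), h, coeff_mul]
  refine IsUltrametricDist.norm_sum_le_of_forall_le_of_nonneg (by positivity) fun ij hij => ?_
  rw [Finset.HasAntidiagonal.mem_antidiagonal] at hij
  rw [le_div_iff₀ (by positivity), coeff_expand]
  split_ifs with hd
  · obtain ⟨m, hm⟩ := hd
    have hpp : 0 < p * p := by positivity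
    rw [hm, Nat.mul_div_cancel_left _ hpp, norm_mul]
    have hmn : m ≤ n / (p * p) := by
      rw [Nat.le_div_iff_mul_le hpp]
      lia
    have hle : (2 * p - 1) * m ≤ n := by
      calc (2 * p - 1) * m ≤ (p * p) * m := by
            gcongr
            have : 2 * p ≤ p * p := Nat.mul_le_mul_right p hp2
            lia
        _ ≤ n := by lia
    have hSm : ‖coeff m S‖ * q ^ ((2 * p - 1) * m) ≤ 1 := by
      have h1 := hS m
      rw [norm_mul, norm_mul, norm_pow, Padic.norm_p, ← hq, ← pow_mul] at h1
      have he : (2 * p - 1) * m = (p - 1) * (2 * m) + m := by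
        obtain ⟨k, rfl⟩ := Nat.exists_eq_succ_of_ne_zero hp.out.ne_zero
        rw [Nat.succ_sub_one, show 2 * k.succ - 1 = 2 * k + 1 by lia]
        ring
      calc _ = q ^ ((p - 1) * (2 * m)) * q ^ m * ‖coeff m S‖ := by rw [he, pow_add]; ring
        _ ≤ q ^ ((p - 1) * (2 * m)) * ‖(m.factorial : ℚ_[p])‖ * ‖coeff m S‖ := by
          gcongr
          exact pow_le_norm_factorial hq0.le hq1 hq m
        _ ≤ 1 := h1
    calc ‖coeff ij.1 F‖ * ‖coeff m S‖ * q ^ n ≤ 1 * ‖coeff m S‖ * q ^ n := by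
          gcongr
          exact hF _
      _ = ‖coeff m S‖ * q ^ ((2 * p - 1) * m) * q ^ (n - (2 * p - 1) * m) := by
          rw [one_mul, mul_assoc, ← pow_add, Nat.add_sub_cancel' hle]
      _ ≤ 1 * q ^ (n - (2 * p - 1) * m) := by gcongr
      _ ≤ q ^ (n - (2 * p - 1) * (n / (p * p))) := by
          rw [one_mul]
          exact pow_le_pow_of_le_one hq0.le hq1 (by gcongr)
  · simp only [mul_zero, norm_zero, zero_mul]
    positivity

end Integrality

section Dwork

variable {p : ℕ} [hp : Fact p.Prime]

theorem coeff_truncatedArtinHasse (n : ℕ) : coeff n (truncatedArtinHasse p) =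
    ∑ j ∈ Finset.range (n / p + 1),
      1 / ((n - p * j).factorial : ℚ_[p]) * ((p : ℚ_[p])⁻¹ ^ j / (j.factorial : ℚ_[p])) := by
  rw [truncatedArtinHasse, mul_comm, coeff_mul, Finset.Nat.sum_antidiagonal_eq_sum_range_succ_mk]
  symm
  refine Finset.sum_of_injOn (fun j => p * j) ?_ ?_ ?_ ?_
  · intro a _ b _ hab
    exact Nat.eq_of_mul_eq_mul_left hp.out.pos hab
  · intro j hj
    simp only [Finset.coe_range, Set.mem_Iio, Nat.lt_succ_iff] at hj ⊢
    exact (Nat.mul_le_mul_left p hj).trans (Nat.mul_div_le n p)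
  · intro i hi hni
    rw [coeff_expand, if_neg, zero_mul]
    rintro ⟨j, rfl⟩
    refine hni ⟨j, ?_, rfl⟩
    simp only [Finset.coe_range, Set.mem_Iio, Finset.mem_range, Nat.lt_succ_iff] at hi ⊢
    rw [Nat.le_div_iff_mul_le hp.out.pos]
    lia
  · intro j _
    rw [coeff_expand_mul, coeff_rescale, coeff_exp, coeff_exp]
    simp
    ring

variable {L : Type*} [NormedField L] [Algebra ℚ_[p] L]

theorem dworkCoeff_eq {γ : L} (hγ : γ ^ (p - 1) = -(p : L)) (n : ℕ) :
    dworkCoeff L p γ n = γ ^ n * algebraMap ℚ_[p] L (coeff n (truncatedArtinHasse p)) := by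
  have : CharZero L := charZero_of_injective_algebraMap (algebraMap ℚ_[p] L).injective
  have hp0 : (p : L) ≠ 0 := by exact_mod_cast hp.out.ne_zero
  have hγp : -γ = γ ^ p * (p : L)⁻¹ := by
    rw [← pow_sub_one_mul hp.out.ne_zero γ, hγ]
    field_simp
  rw [dworkCoeff, coeff_truncatedArtinHasse, map_sum, Finset.mul_sum]
  refine Finset.sum_congr rfl fun j hj => ?_
  have hle : p * j ≤ n := by
    rw [Finset.mem_range, Nat.lt_succ_iff] at hj
    exact (Nat.mul_le_mul_left p hj).trans (Nat.mul_div_le n p)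
  simp only [map_mul, map_div₀, map_one, map_natCast, map_pow, map_inv₀]
  rw [hγp, mul_pow, ← pow_mul]
  calc _ = γ ^ (n - p * j) * γ ^ (p * j) * (1 / ((n - p * j).factorial : L) *
        ((p : L)⁻¹ ^ j / (j.factorial : L))) := by ring
    _ = _ := by rw [← pow_add, Nat.sub_add_cancel hle]

theorem norm_natCast_eq (hnorm : ∀ q : ℚ_[p], ‖algebraMap ℚ_[p] L q‖ = ‖q‖) (n : ℕ) :
    ‖(n : L)‖ = ‖(n : ℚ_[p])‖ := by
  rw [← hnorm, map_natCast]

theorem norm_pow_sub_one_eq (hnorm : ∀ q : ℚ_[p], ‖algebraMap ℚ_[p] L q‖ = ‖q‖) {γ : L}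
    (hγ : γ ^ (p - 1) = -(p : L)) : ‖γ‖ ^ (p - 1) = (p : ℝ)⁻¹ := by
  rw [← norm_pow, hγ, norm_neg, norm_natCast_eq hnorm, Padic.norm_p]

theorem norm_lt_one_of_pow_eq (hnorm : ∀ q : ℚ_[p], ‖algebraMap ℚ_[p] L q‖ = ‖q‖) {γ : L}
    (hγ : γ ^ (p - 1) = -(p : L)) : ‖γ‖ < 1 := by
  have h1 : ((p : ℝ))⁻¹ < 1 := inv_lt_one_of_one_lt₀ (by exact_mod_cast hp.out.one_lt)
  by_contra! h
  have := one_le_pow₀ h (n := p - 1)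
  rw [norm_pow_sub_one_eq hnorm hγ] at this
  linarith

theorem norm_dworkCoeff_le (hnorm : ∀ q : ℚ_[p], ‖algebraMap ℚ_[p] L q‖ = ‖q‖) {γ : L}
    (hγ : γ ^ (p - 1) = -(p : L)) (n : ℕ) :
    ‖dworkCoeff L p γ n‖ ≤ ‖γ‖ ^ (n - (2 * p - 1) * (n / (p * p))) := by
  have hγ0 : γ ≠ 0 := by
    rintro rfl
    have h := norm_pow_sub_one_eq hnorm hγ
    have hp1 := norm_lt_one_of_pow_eq hnorm hγ
    rw [norm_zero, zero_pow_eq] at h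
    split_ifs at h
    · have : (1 : ℝ) < p := by exact_mod_cast hp.out.one_lt
      have := inv_lt_one_of_one_lt₀ this
      linarith
    · have : (0 : ℝ) < p := by exact_mod_cast hp.out.pos
      have := inv_pos.mpr this
      linarith
  rw [dworkCoeff_eq hγ, norm_mul, hnorm, norm_pow, mul_comm]
  exact norm_coeff_truncatedArtinHasse_mul_pow_le (norm_pos_iff.mpr hγ0)
    (norm_lt_one_of_pow_eq hnorm hγ).le (norm_pow_sub_one_eq hnorm hγ) n

theorem four_mul_le_nine_mul_sub {p : ℕ} (hp : 3 ≤ p) (n : ℕ) :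
    4 * n ≤ 9 * (n - (2 * p - 1) * (n / (p * p))) := by
  have h1 : p * p * (n / (p * p)) ≤ n := Nat.mul_div_le n (p * p)
  have h2 : 9 * (2 * p - 1) ≤ 5 * (p * p) := by
    obtain ⟨k, rfl⟩ := Nat.exists_eq_add_of_le hp
    rw [show 2 * (3 + k) - 1 = 5 + 2 * k by lia]
    nlinarith
  have h3 : 9 * (2 * p - 1) * (n / (p * p)) ≤ 5 * (p * p) * (n / (p * p)) :=
    Nat.mul_le_mul_right _ h2
  rw [mul_assoc, mul_assoc] at h3
  lia

theorem two_le_sub {p : ℕ} (hp : 3 ≤ p) {n : ℕ} (hn : 2 ≤ n) :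
    2 ≤ n - (2 * p - 1) * (n / (p * p)) := by
  have h := four_mul_le_nine_mul_sub hp n
  rcases hn.eq_or_lt with rfl | hn
  · rw [Nat.div_eq_of_lt (by nlinarith)]
    simp
  · lia

variable [CompleteSpace L]

theorem summable_dworkCoeff (hp3 : 3 ≤ p) [IsUltrametricDist L]
    (hnorm : ∀ q : ℚ_[p], ‖algebraMap ℚ_[p] L q‖ = ‖q‖) {γ : L}
    (hγ : γ ^ (p - 1) = -(p : L)) : Summable (dworkCoeff L p γ) := by
  apply NonarchimedeanAddGroup.summable_of_tendsto_cofinite_zero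
  rw [Nat.cofinite_eq_atTop]
  refine squeeze_zero_norm (norm_dworkCoeff_le hnorm hγ) ?_
  refine (tendsto_pow_atTop_nhds_zero_of_lt_one (norm_nonneg _)
    (norm_lt_one_of_pow_eq hnorm hγ)).comp ?_
  refine Filter.tendsto_atTop_mono (f := fun n => n / 3) (fun n => ?_)
    (Nat.tendsto_div_const_atTop (by norm_num))
  have := four_mul_le_nine_mul_sub hp3 n
  lia

end Dwork

theorem norm_sub_eq_of_pow_eq {p : ℕ} [hp : Fact p.Prime] {L : Type*} [NormedField L]
    [Algebra ℚ_[p] L] [IsUltrametricDist L]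
    (hnorm : ∀ q : ℚ_[p], ‖algebraMap ℚ_[p] L q‖ = ‖q‖) {x y : L} (hy : y ≠ 0)
    (h : x ^ (p - 1) = y ^ (p - 1)) (hxy : x ≠ y) : ‖y‖ ≤ ‖x - y‖ := by
  by_contra! hlt
  set ζ := x / y with hζ
  have hsub : x - y = (ζ - 1) * y := by rw [hζ]; field_simp
  have h1 : ‖ζ - 1‖ < 1 := by
    rw [hsub, norm_mul] at hlt
    exact (mul_lt_iff_lt_one_left (norm_pos_iff.mpr hy)).mp hlt
  have hζ1 : ζ - 1 ≠ 0 := by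
    intro h0
    rw [h0, zero_mul, sub_eq_zero] at hsub
    exact hxy hsub
  have hζle : ‖ζ‖ ≤ 1 := by
    have := IsUltrametricDist.norm_add_le_max (ζ - 1) 1
    rw [sub_add_cancel, norm_one] at this
    exact this.trans (max_le h1.le le_rfl)
  have hζp : ζ ^ (p - 1) = 1 := by rw [hζ, div_pow, h, div_self (pow_ne_zero _ hy)]
  have hsum : ∑ i ∈ Finset.range (p - 1), ζ ^ i = 0 := by
    have := mul_geom_sum ζ (p - 1)
    rw [hζp, sub_self] at this
    exact (mul_eq_zero.mp this).resolve_left hζ1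
  have hdvd : ∀ i, ‖ζ ^ i - 1‖ ≤ ‖ζ - 1‖ := fun i => by
    rw [← mul_geom_sum, norm_mul]
    refine mul_le_of_le_one_right (norm_nonneg _) ?_
    refine IsUltrametricDist.norm_sum_le_of_forall_le_of_nonneg zero_le_one fun j _ => ?_
    rw [norm_pow]
    exact pow_le_one₀ (norm_nonneg _) hζle
  have hone : (1 : L) = p + ∑ i ∈ Finset.range (p - 1), (ζ ^ i - 1) := by
    rw [Finset.sum_sub_distrib, hsum, Finset.sum_const, Finset.card_range, nsmul_one,
      Nat.cast_pred hp.out.pos]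
    ring
  have hlt1 : ‖(1 : L)‖ < 1 := by
    rw [hone]
    refine (IsUltrametricDist.norm_add_le_max _ _).trans_lt (max_lt ?_ ?_)
    · rw [norm_natCast_eq hnorm, Padic.norm_p]
      exact inv_lt_one_of_one_lt₀ (by exact_mod_cast hp.out.one_lt)
    · exact (IsUltrametricDist.norm_sum_le_of_forall_le_of_nonneg (norm_nonneg _)
        fun i _ => hdvd i).trans_lt h1
  rw [norm_one] at hlt1
  exact lt_irrefl _ hlt1

/-- Distinct choices of `γ` give distinct primitive `p`-th roots of unity: if
`γ^(p−1) = −p = γ′^(p−1)` and `E_γ(1) = E_{γ′}(1)`, then `γ = γ′`. -/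
theorem dworkSeries_one_injective
    (p : ℕ) [Fact p.Prime] (L : Type*) [NormedField L] [CompleteSpace L]
    [Algebra ℚ_[p] L] (hnorm : ∀ q : ℚ_[p], ‖algebraMap ℚ_[p] L q‖ = ‖q‖)
    (γ γ' : L) (hγ : γ ^ (p - 1) = -(p : L)) (hγ' : γ' ^ (p - 1) = -(p : L))
    (h : ∑' n : ℕ, dworkCoeff L p γ n = ∑' n : ℕ, dworkCoeff L p γ' n) :
    γ = γ' := by
  have : CharZero L := charZero_of_injective_algebraMap (algebraMap ℚ_[p] L).injective
  have : IsUltrametricDist L :=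
    IsUltrametricDist.isUltrametricDist_of_forall_norm_natCast_le_one fun n => by
      rw [norm_natCast_eq hnorm]
      exact IsUltrametricDist.norm_natCast_le_one _ n
  have hp : p.Prime := Fact.out
  rcases hp.two_le.eq_or_lt with rfl | hp3
  · simpa using hγ.trans hγ'.symm
  by_contra hne
  have hp0 : (p : L) ≠ 0 := by exact_mod_cast hp.ne_zero
  have hγ0 : γ ≠ 0 := by
    rintro rfl
    rw [zero_pow (by lia), eq_comm, neg_eq_zero] at hγ
    exact hp0 hγ
  have hnn : ‖γ'‖ = ‖γ‖ := by
    refine (pow_left_inj₀ (norm_nonneg _) (norm_nonneg _) (show p - 1 ≠ 0 by lia)).mp ?_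
    rw [← norm_pow, ← norm_pow, hγ, hγ']
  have hlt := norm_lt_one_of_pow_eq hnorm hγ
  have hpos : 0 < ‖γ‖ := norm_pos_iff.mpr hγ0
  have hs := summable_dworkCoeff hp3 hnorm hγ
  have hs' := summable_dworkCoeff hp3 hnorm hγ'
  have hd := hs'.sub hs
  have hone (x : L) (hx : x ^ (p - 1) = -(p : L)) : dworkCoeff L p x 1 = x := by
    simp [dworkCoeff, Nat.div_eq_of_lt hp.one_lt]
  have hzero (x : L) : dworkCoeff L p x 0 = 1 := by simp [dworkCoeff]
  have htail := hd.sum_add_tsum_nat_add 2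
  rw [hs'.tsum_sub hs, h, sub_self, Finset.sum_range_succ, Finset.sum_range_one, hzero, hzero,
    hone γ hγ, hone γ' hγ', sub_self, zero_add, add_eq_zero_iff_eq_neg] at htail
  have hle : ‖∑' n, (dworkCoeff L p γ' (n + 2) - dworkCoeff L p γ (n + 2))‖ ≤ ‖γ‖ ^ 2 := by
    refine isClosed_le continuous_norm continuous_const |>.mem_of_tendsto
      ((summable_nat_add_iff 2).mpr hd).hasSum (Filter.Eventually.of_forall fun s => ?_)
    refine IsUltrametricDist.norm_sum_le_of_forall_le_of_nonneg (by positivity) fun n _ => ?_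
    have h2 := pow_le_pow_of_le_one hpos.le hlt.le (two_le_sub hp3 (Nat.le_add_left 2 n))
    have h3 := norm_dworkCoeff_le hnorm hγ' (n + 2)
    rw [hnn] at h3
    rw [sub_eq_add_neg]
    refine (IsUltrametricDist.norm_add_le_max _ _).trans (max_le (h3.trans h2) ?_)
    rw [norm_neg]
    exact (norm_dworkCoeff_le hnorm hγ (n + 2)).trans h2
  have hge := norm_sub_eq_of_pow_eq hnorm hγ0 (hγ'.trans hγ.symm) (Ne.symm hne)
  rw [htail, norm_neg] at hge
  nlinarith
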